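/- Let V be a nonempty finite type and k ≥ 1. Let P be a probability mass function on the product space V^k (sequences y = (y_1, …, y_k)), let P_t denote the t-th marginal of P, and for t ≥ 2 let P(· | y_{<t}) denote the conditional distribution of the t-th coordinate given the first t−1 coordinates (defined whenever the history y_{<t} has positive probability). Let D ∈ ℝ^{k×k} be a matrix with nonnegative entries and let τ ≥ 0. Assume (sub-additivity) that for every t ∈ {2, …, k}, the expectation over histories Y_{<t} drawn from P of TV(P(· | Y_{<t}), P_t) is at most Σ_{j=1}^{t−1} D_{t,j}, and assume Σ_{t=2}^{k} Σ_{j=1}^{t−1} D_{t,j} ≤ τ. Then TV(P, ⊗_{t=1}^{k} P_t) ≤ τ, where ⊗_{t=1}^{k} P_t is the product of the marginals. -/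

import Mathlib

open Finset

/-- Total variation distance between two mass functions on a finite type:
`TV(p, q) = (1/2) ∑ₓ |p x - q x|`. -/
noncomputable def tv {X : Type*} [Fintype X] (p q : X → ℝ) : ℝ :=
  (1 / 2) * ∑ x, |p x - q x|

/-- The `t`-th marginal of a mass function `P` on `Fin k → V`. -/
noncomputable def marg {V : Type*} [Fintype V] [DecidableEq V] {k : ℕ}
    (P : (Fin k → V) → ℝ) (t : Fin k) (v : V) : ℝ :=
  ∑ y : Fin k → V, if y t = v then P y else 0

/-- Probability under `P` that the first `t` coordinates agree with those of `z`. -/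
noncomputable def prefProb {V : Type*} [Fintype V] [DecidableEq V] {k : ℕ}
    (P : (Fin k → V) → ℝ) (t : ℕ) (z : Fin k → V) : ℝ :=
  ∑ y : Fin k → V, if ∀ i : Fin k, (i : ℕ) < t → y i = z i then P y else 0

/-- Conditional distribution of coordinate `t` given that the coordinates before `t`
equal those of `z` (Lean's division-by-zero convention handles zero-probability
histories, which are anyway weighted by zero below). -/
noncomputable def condD {V : Type*} [Fintype V] [DecidableEq V] {k : ℕ}
    (P : (Fin k → V) → ℝ) (t : Fin k) (z : Fin k → V) (v : V) : ℝ :=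
  prefProb P ((t : ℕ) + 1) (Function.update z t v) / prefProb P (t : ℕ) z

/-- Extend a history on the first `t` coordinates to a full configuration. -/
noncomputable def extendHist {V : Type*} [Nonempty V] {k t : ℕ}
    (h : Fin t → V) : Fin k → V :=
  fun i => if hi : (i : ℕ) < t then h ⟨i, hi⟩ else Classical.arbitrary V

/-- Expectation, over histories `Y_{<t}` drawn from `P`, of the total variation
distance between the conditional distribution of the `t`-th coordinate given the
history and the `t`-th marginal. -/
noncomputable def expCondTV {V : Type*} [Fintype V] [DecidableEq V] [Nonempty V] {k : ℕ}
    (P : (Fin k → V) → ℝ) (t : Fin k) : ℝ :=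
  ∑ h : Fin (t : ℕ) → V,
    prefProb P (t : ℕ) (extendHist h) * tv (condD P t (extendHist h)) (marg P t)

section Helpers

theorem extendHist_self {V : Type*} [Nonempty V] {k : ℕ} (z : Fin k → V) :
    (extendHist z : Fin k → V) = z := by
  ext i
  simp [extendHist]

variable {V : Type*} [Fintype V] [DecidableEq V] {k : ℕ} {P : (Fin k → V) → ℝ}

theorem marg_nonneg (hP0 : ∀ y, 0 ≤ P y) (t : Fin k) (v : V) : 0 ≤ marg P t v :=
  Finset.sum_nonneg fun y _ => by split_ifs <;> simp [hP0 y]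

theorem sum_marg (P : (Fin k → V) → ℝ) (t : Fin k) : ∑ v, marg P t v = ∑ y, P y := by
  unfold marg
  rw [Finset.sum_comm]
  simp

theorem prefProb_nonneg (hP0 : ∀ y, 0 ≤ P y) (t : ℕ) (z : Fin k → V) :
    0 ≤ prefProb P t z :=
  Finset.sum_nonneg fun y _ => by split_ifs <;> simp [hP0 y]

theorem prefProb_zero (P : (Fin k → V) → ℝ) (z : Fin k → V) :
    prefProb P 0 z = ∑ y, P y := by
  simp [prefProb]

theorem prefProb_self (P : (Fin k → V) → ℝ) (z : Fin k → V) : prefProb P k z = P z := by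
  simp [prefProb, ← funext_iff]

theorem prefProb_congr (P : (Fin k → V) → ℝ) {t : ℕ} {z w : Fin k → V}
    (h : ∀ i : Fin k, (i : ℕ) < t → z i = w i) : prefProb P t z = prefProb P t w := by
  unfold prefProb
  refine Finset.sum_congr rfl fun y _ => if_congr ?_ rfl rfl
  exact forall₂_congr fun i hi => by rw [h i hi]

theorem prefProb_succ_update_le (hP0 : ∀ y, 0 ≤ P y) (t : Fin k) (z : Fin k → V) (v : V) :
    prefProb P ((t : ℕ) + 1) (Function.update z t v) ≤ prefProb P (t : ℕ) z := by
  refine Finset.sum_le_sum fun y _ => ?_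
  by_cases h : ∀ i : Fin k, (i : ℕ) < t + 1 → y i = Function.update z t v i
  · have h' : ∀ i : Fin k, (i : ℕ) < t → y i = z i := fun i hi => by
      rw [h i (by omega), Function.update_of_ne (Fin.ne_of_lt hi)]
    rw [if_pos h, if_pos h']
  · rw [if_neg h]
    split_ifs
    exacts [hP0 y, le_rfl]

theorem prefProb_mul_condD (hP0 : ∀ y, 0 ≤ P y) (t : Fin k) (z : Fin k → V) (v : V) :
    prefProb P (t : ℕ) z * condD P t z v =
      prefProb P ((t : ℕ) + 1) (Function.update z t v) := by
  unfold condD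
  refine mul_div_cancel_of_imp' fun h0 => le_antisymm ?_ (prefProb_nonneg hP0 _ _)
  exact h0 ▸ prefProb_succ_update_le hP0 t z v

variable [Nonempty V]

theorem prefProb_extendHist_snoc (P : (Fin k → V) → ℝ) (t : Fin k) (h : Fin (t : ℕ) → V)
    (v : V) :
    prefProb P ((t : ℕ) + 1) (extendHist (Fin.snoc h v : Fin ((t : ℕ) + 1) → V)) =
      prefProb P ((t : ℕ) + 1) (Function.update (extendHist h) t v) := by
  refine prefProb_congr P fun i hi => ?_
  rcases (Nat.lt_succ_iff_lt_or_eq.mp hi) with hlt | heq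
  · rw [Function.update_of_ne (Fin.ne_of_lt hlt)]
    simp [extendHist, Fin.snoc, hi, hlt]
  · obtain rfl : i = t := Fin.ext heq
    simp [extendHist, Fin.snoc]

theorem expCondTV_eq_zero (hP1 : ∑ y, P y = 1) (t : Fin k) (ht : (t : ℕ) = 0) :
    expCondTV P t = 0 := by
  refine Finset.sum_eq_zero fun h _ => mul_eq_zero_of_right _ ?_
  have key : ∀ v, condD P t (extendHist h) v = marg P t v := fun v => by
    have hone : prefProb P (t : ℕ) (extendHist h) = 1 := by
      generalize (extendHist h : Fin k → V) = z
      rw [ht, prefProb_zero, hP1]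
    rw [condD, hone, div_one]
    refine Finset.sum_congr rfl fun y _ => if_congr ⟨fun H => ?_, fun H i hi => ?_⟩ rfl rfl
    · simpa using H t (Nat.lt_succ_self _)
    · obtain rfl : i = t := Fin.ext (by omega)
      simpa using H
  simp [tv, key]

/-- Revealing one more coordinate increases the distance between the joint and product
prefix laws by at most the expected conditional distance of that coordinate. -/
theorem sum_abs_prefProb_snoc_sub_le (hP0 : ∀ y, 0 ≤ P y) (hP1 : ∑ y, P y = 1) (t : Fin k)
    (q : (Fin (t : ℕ) → V) → ℝ) :
    ∑ h : Fin (t : ℕ) → V, ∑ v,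
        |prefProb P ((t : ℕ) + 1) (extendHist (Fin.snoc h v : Fin ((t : ℕ) + 1) → V)) -
          q h * marg P t v| ≤
      ∑ h : Fin (t : ℕ) → V, |prefProb P (t : ℕ) (extendHist h) - q h| +
        2 * expCondTV P t := by
  rw [expCondTV, Finset.mul_sum, ← Finset.sum_add_distrib]
  refine Finset.sum_le_sum fun h _ => ?_
  set p := prefProb P (t : ℕ) (extendHist h) with hp
  have hp0 : 0 ≤ p := prefProb_nonneg hP0 _ _
  calc _ ≤ ∑ v, (|p - q h| * marg P t v +
            p * |condD P t (extendHist h) v - marg P t v|) := by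
        refine Finset.sum_le_sum fun v _ => ?_
        rw [prefProb_extendHist_snoc, ← prefProb_mul_condD hP0, ← hp,
          ← abs_of_nonneg (marg_nonneg hP0 t v), ← abs_mul,
          abs_of_nonneg (marg_nonneg hP0 t v)]
        nth_rewrite 3 [← abs_of_nonneg hp0]
        rw [← abs_mul]
        refine le_trans (le_of_eq ?_) (abs_add_le _ _)
        congr 1
        ring
    _ = _ := by
        rw [Finset.sum_add_distrib, ← Finset.mul_sum, ← Finset.mul_sum, sum_marg, hP1, tv]
        ring

theorem sum_abs_prefProb_sub_prod_marg_le (hP0 : ∀ y, 0 ≤ P y) (hP1 : ∑ y, P y = 1) (n : ℕ)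
    (hn : n ≤ k) :
    ∑ h : Fin n → V,
        |prefProb P n (extendHist h) - ∏ i, marg P (Fin.castLE hn i) (h i)| ≤
      2 * ∑ i, expCondTV P (Fin.castLE hn i) := by
  induction n with
  | zero => simp [prefProb_zero, hP1]
  | succ n ih =>
    rw [Fin.sum_univ_castSucc, mul_add, ← (Fin.snocEquiv fun _ => V).sum_comp,
      Fintype.sum_prod_type_right]
    refine le_trans (le_of_eq ?_) ((sum_abs_prefProb_snoc_sub_le hP0 hP1 ⟨n, hn⟩
      fun h => ∏ i, marg P (Fin.castLE (Nat.le_of_succ_le hn) i) (h i)).trans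
        (add_le_add_left (ih (Nat.le_of_succ_le hn)) _))
    refine Finset.sum_congr rfl fun h _ => Finset.sum_congr rfl fun v _ => ?_
    rw [Fin.prod_univ_castSucc]
    simp only [Fin.snocEquiv_apply, Fin.snoc_castSucc, Fin.snoc_last]
    rfl

end Helpers

/-- Theorem 1 of the paper, algorithm-free form. If the dependency
of each coordinate on its history is sub-additive in the pairwise dependencies `D`,
and the accumulated pairwise dependency is at most `τ`, then the total variation
distance between the joint `P` and the product of its marginals is at most `τ`. -/
theorem stmt0 {V : Type*} [Fintype V] [DecidableEq V] [Nonempty V] {k : ℕ} (hk : 1 ≤ k)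
    (P : (Fin k → V) → ℝ) (hP0 : ∀ y, 0 ≤ P y) (hP1 : ∑ y, P y = 1)
    (D : Fin k → Fin k → ℝ) (hD : ∀ i j, 0 ≤ D i j)
    (τ : ℝ) (hτ : 0 ≤ τ)
    (hsub : ∀ t : Fin k, 1 ≤ (t : ℕ) →
      expCondTV P t ≤ ∑ j ∈ univ.filter (fun j : Fin k => j < t), D t j)
    (hsum : ∑ t ∈ univ.filter (fun t : Fin k => 1 ≤ (t : ℕ)),
        ∑ j ∈ univ.filter (fun j : Fin k => j < t), D t j ≤ τ) :
    tv P (fun y => ∏ t, marg P t (y t)) ≤ τ := by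
  have hmain := sum_abs_prefProb_sub_prod_marg_le hP0 hP1 k le_rfl
  simp only [extendHist_self, prefProb_self, Fin.castLE_rfl, id_eq] at hmain
  have hexp : ∑ t, expCondTV P t ≤ τ := by
    refine le_trans ?_ hsum
    rw [Finset.sum_filter]
    refine Finset.sum_le_sum fun t _ => ?_
    split_ifs with ht
    · exact hsub t ht
    · exact (expCondTV_eq_zero hP1 t (by omega)).le
  unfold tv
  linarith
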